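/- The number of quadrangulations of a convex polygon with 2n+2 vertices (decompositions into n disjoint quadrilaterals by non-crossing diagonals) equals (3n)!/(n!·(2n+1)!). -/

import Mathlib

/-- Two chords `p, q` of a convex polygon (with vertices `0,…,N` in cyclic order), recorded as
pairs of vertices with `p.1 < p.2` and `q.1 < q.2`, cross each other. -/
def ChordsCross (p q : ℕ × ℕ) : Prop :=
  (p.1 < q.1 ∧ q.1 < p.2 ∧ p.2 < q.2) ∨ (q.1 < p.1 ∧ p.1 < q.2 ∧ q.2 < p.2)

/-- `p` is a diagonal of the convex `(2n+2)`-gon (vertices `0,…,2n+1`) joining two vertices of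
opposite parity; such diagonals are exactly the ones that can occur in a decomposition of the
polygon into quadrilaterals. -/
def IsQuadDiag (n : ℕ) (p : ℕ × ℕ) : Prop :=
  p.1 < p.2 ∧ p.2 ≤ 2 * n + 1 ∧ Odd (p.2 - p.1) ∧ p.2 - p.1 ≠ 1 ∧ ¬(p.1 = 0 ∧ p.2 = 2 * n + 1)

/-- A quadrangulation of the convex `(2n+2)`-gon: a set of `n-1` pairwise non-crossing diagonals
each joining vertices of opposite parity; equivalently, a decomposition of the polygon into `n`
disjoint quadrilaterals by non-crossing diagonals. -/
def IsQuadrangulation (n : ℕ) (D : Finset (ℕ × ℕ)) : Prop :=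
  D.card = n - 1 ∧ (∀ p ∈ D, IsQuadDiag n p) ∧ ∀ p ∈ D, ∀ q ∈ D, ¬ ChordsCross p q

namespace QuadCount

/-- Valid sets of odd chords (the root edge is allowed). -/
def V (n : ℕ) (D : Finset (ℕ × ℕ)) : Prop :=
  (∀ p ∈ D, p.1 + 3 ≤ p.2 ∧ p.2 ≤ 2 * n + 1 ∧ (p.2 - p.1) % 2 = 1) ∧
    ∀ p ∈ D, ∀ q ∈ D, ¬ ChordsCross p q

/-- insert two vertices after `w` -/
def sg (w x : ℕ) : ℕ := if x ≤ w then x else x + 2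
/-- delete two vertices after `w` -/
def ta (w x : ℕ) : ℕ := if x ≤ w then x else x - 2

/-- `sg` on pairs -/
def sgp (w : ℕ) (p : ℕ × ℕ) : ℕ × ℕ := (sg w p.1, sg w p.2)
/-- `ta` on pairs -/
def tap (w : ℕ) (p : ℕ × ℕ) : ℕ × ℕ := (ta w p.1, ta w p.2)

lemma tap_sgp (w : ℕ) (p : ℕ × ℕ) : tap w (sgp w p) = p := by
  obtain ⟨a, b⟩ := p
  simp only [tap, sgp, ta, sg, Prod.mk.injEq]
  constructor <;> split_ifs <;> omega

lemma ear_facts {n v : ℕ} {D : Finset (ℕ × ℕ)} (h : V n D) (he : (v, v + 3) ∈ D)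
    (hv : ∀ p ∈ D, p.1 ≤ v) {p : ℕ × ℕ} (hp : p ∈ D.erase (v, v + 3)) :
    p.1 ≤ v ∧ (p.2 ≤ v ∨ v + 3 ≤ p.2) ∧ ¬ (p.1 = v ∧ p.2 = v + 3) := by
  rw [Finset.mem_erase] at hp
  obtain ⟨hne, hp⟩ := hp
  have h1 := h.1 p hp
  have h2 := h.2 p hp _ he
  have h3 := hv p hp
  obtain ⟨a, b⟩ := p
  simp only [ChordsCross, ne_eq, Prod.mk.injEq] at *
  refine ⟨h3, ?_, hne⟩
  omega

lemma sgp_tap {n v : ℕ} {D : Finset (ℕ × ℕ)} (h : V n D) (he : (v, v + 3) ∈ D)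
    (hv : ∀ p ∈ D, p.1 ≤ v) {p : ℕ × ℕ} (hp : p ∈ D.erase (v, v + 3)) :
    sgp v (tap v p) = p := by
  have h1 := ear_facts h he hv hp
  obtain ⟨a, b⟩ := p
  simp only [tap, sgp, ta, sg, Prod.mk.injEq] at *
  constructor <;> split_ifs <;> omega

lemma contract {n v : ℕ} {D : Finset (ℕ × ℕ)} (h : V (n + 1) D) (he : (v, v + 3) ∈ D)
    (hv : ∀ p ∈ D, p.1 ≤ v) :
    V n ((D.erase (v, v + 3)).image (tap v)) ∧
    ((D.erase (v, v + 3)).image (tap v)).card + 1 = D.card ∧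
    (∀ p ∈ (D.erase (v, v + 3)).image (tap v), p.1 ≤ v) ∧
    insert (v, v + 3) (((D.erase (v, v + 3)).image (tap v)).image (sgp v)) = D := by
  have hev := h.1 _ he
  refine ⟨⟨?_, ?_⟩, ?_, ?_, ?_⟩
  · intro p hp
    obtain ⟨q, hq, rfl⟩ := Finset.mem_image.1 hp
    have h1 := ear_facts h he hv hq
    have h2 := h.1 q (Finset.mem_of_mem_erase hq)
    obtain ⟨a, b⟩ := q
    simp only [tap, ta] at *
    split_ifs <;> omega
  · intro p hp p' hp'
    obtain ⟨q, hq, rfl⟩ := Finset.mem_image.1 hp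
    obtain ⟨q', hq', rfl⟩ := Finset.mem_image.1 hp'
    have h1 := ear_facts h he hv hq
    have h2 := h.1 q (Finset.mem_of_mem_erase hq)
    have h1' := ear_facts h he hv hq'
    have h2' := h.1 q' (Finset.mem_of_mem_erase hq')
    have h3 := h.2 q (Finset.mem_of_mem_erase hq) q' (Finset.mem_of_mem_erase hq')
    obtain ⟨a, b⟩ := q
    obtain ⟨a', b'⟩ := q'
    simp only [tap, ta, ChordsCross] at *
    split_ifs <;> omega
  · rw [Finset.card_image_of_injOn, Finset.card_erase_add_one he]
    intro p hp q hq hpq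
    rw [← sgp_tap h he hv hp, hpq, sgp_tap h he hv hq]
  · intro p hp
    obtain ⟨q, hq, rfl⟩ := Finset.mem_image.1 hp
    have h1 := ear_facts h he hv hq
    simp only [tap, ta]
    split_ifs <;> omega
  · rw [Finset.image_image]
    have : (D.erase (v, v + 3)).image (sgp v ∘ tap v) = (D.erase (v, v + 3)).image id :=
      Finset.image_congr (fun p hp => sgp_tap h he hv hp)
    rw [this, Finset.image_id, Finset.insert_erase he]

lemma add_ear {n v : ℕ} {D : Finset (ℕ × ℕ)} (h : V n D) (he : ∃ p ∈ D, p.1 = v)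
    (hv : ∀ p ∈ D, p.1 ≤ v) : V n (insert (v, v + 3) D) := by
  obtain ⟨e, heD, rfl⟩ := he
  have he1 := h.1 e heD
  have key : ∀ q ∈ D, ¬ ChordsCross (e.1, e.1 + 3) q ∧ ¬ ChordsCross q (e.1, e.1 + 3) := by
    intro q hq
    have h1 := h.1 q hq
    have h2 := h.2 q hq e heD
    have h3 := hv q hq
    simp only [ChordsCross] at *
    omega
  refine ⟨?_, ?_⟩
  · intro p hp
    rcases Finset.mem_insert.1 hp with rfl | hp
    · dsimp only; omega
    · exact h.1 p hp
  · intro p hp q hq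
    rcases Finset.mem_insert.1 hp with rfl | hp <;> rcases Finset.mem_insert.1 hq with rfl | hq
    · simp [ChordsCross]
    · exact (key q hq).1
    · exact (key p hp).2
    · exact h.2 p hp q hq

lemma V_card_le (n : ℕ) : ∀ D : Finset (ℕ × ℕ), V n D → D.card ≤ n := by
  induction n with
  | zero =>
    intro D h
    rw [Nat.le_zero, Finset.card_eq_zero, Finset.eq_empty_iff_forall_notMem]
    intro p hp
    have := h.1 p hp
    omega
  | succ n ih =>
    intro D h
    rcases D.eq_empty_or_nonempty with rfl | hne
    · simp
    · obtain ⟨e, he, hmax⟩ := Finset.exists_max_image D Prod.fst hne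
      have h' := add_ear h ⟨e, he, rfl⟩ hmax
      have hc := contract h' (Finset.mem_insert_self _ _) (by
        intro p hp
        rcases Finset.mem_insert.1 hp with rfl | hp
        · exact le_rfl
        · exact hmax p hp)
      have h1 := ih _ hc.1
      have h2 := hc.2.1
      have h3 : D.card ≤ (insert (e.1, e.1 + 3) D).card :=
        Finset.card_le_card (Finset.subset_insert _ _)
      omega

lemma ear_mem {n v : ℕ} {D : Finset (ℕ × ℕ)} (h : V n D) (hc : D.card = n)
    (he : ∃ p ∈ D, p.1 = v) (hv : ∀ p ∈ D, p.1 ≤ v) : (v, v + 3) ∈ D := by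
  by_contra hn
  have h1 := V_card_le _ _ (add_ear h he hv)
  rw [Finset.card_insert_of_notMem hn] at h1
  omega

/-- full sets with all left end points `< w` -/
def S (n w : ℕ) : Set (Finset (ℕ × ℕ)) := {D | V n D ∧ D.card = n ∧ ∀ p ∈ D, p.1 < w}

lemma S_finite (n w : ℕ) : (S n w).Finite := by
  refine Set.Finite.subset
    (Finset.finite_toSet (Finset.range (2 * n + 2) ×ˢ Finset.range (2 * n + 2)).powerset) ?_
  intro D hD
  simp only [Finset.coe_powerset, Set.mem_preimage, Set.mem_powerset_iff, Finset.coe_subset]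
  intro p hp
  have := hD.1.1 p hp
  simp only [Finset.mem_product, Finset.mem_range]
  omega

lemma expand_mem {n w : ℕ} (hw : w ≤ 2 * n) {D : Finset (ℕ × ℕ)} (hD : D ∈ S n (w + 1)) :
    insert (w, w + 3) (D.image (sgp w)) ∈ S (n + 1) (w + 1) ∧
    (w, w + 3) ∉ D.image (sgp w) := by
  obtain ⟨h, hc, hl⟩ := hD
  have hn : (w, w + 3) ∉ D.image (sgp w) := by
    intro hm
    obtain ⟨q, hq, hqe⟩ := Finset.mem_image.1 hm
    have h1 := h.1 q hq
    simp only [sgp, sg, Prod.mk.injEq] at hqe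
    split_ifs at hqe <;> omega
  refine ⟨⟨⟨?_, ?_⟩, ?_, ?_⟩, hn⟩
  · intro p hp
    rcases Finset.mem_insert.1 hp with rfl | hp
    · dsimp only; omega
    · obtain ⟨q, hq, rfl⟩ := Finset.mem_image.1 hp
      have h1 := h.1 q hq
      have h2 := hl q hq
      simp only [sgp, sg]
      split_ifs <;> omega
  · intro p hp p' hp'
    rcases Finset.mem_insert.1 hp with rfl | hp <;> rcases Finset.mem_insert.1 hp' with rfl | hp'
    · simp [ChordsCross]
    · obtain ⟨q, hq, rfl⟩ := Finset.mem_image.1 hp'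
      have h1 := h.1 q hq
      have h2 := hl q hq
      simp only [sgp, sg, ChordsCross]
      split_ifs <;> omega
    · obtain ⟨q, hq, rfl⟩ := Finset.mem_image.1 hp
      have h1 := h.1 q hq
      have h2 := hl q hq
      simp only [sgp, sg, ChordsCross]
      split_ifs <;> omega
    · obtain ⟨q, hq, rfl⟩ := Finset.mem_image.1 hp
      obtain ⟨q', hq', rfl⟩ := Finset.mem_image.1 hp'
      have h1 := h.1 q hq
      have h2 := hl q hq
      have h1' := h.1 q' hq'
      have h2' := hl q' hq'
      have h3 := h.2 q hq q' hq'
      simp only [sgp, sg, ChordsCross] at *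
      split_ifs <;> omega
  · rw [Finset.card_insert_of_notMem hn, Finset.card_image_of_injective, hc]
    exact Function.LeftInverse.injective (tap_sgp w)
  · intro p hp
    rcases Finset.mem_insert.1 hp with rfl | hp
    · dsimp only; omega
    · obtain ⟨q, hq, rfl⟩ := Finset.mem_image.1 hp
      have h2 := hl q hq
      simp only [sgp, sg]
      split_ifs <;> omega

lemma S_split {n w : ℕ} (hw : w ≤ 2 * n) :
    S (n + 1) (w + 1) = S (n + 1) w ∪
      (fun D : Finset (ℕ × ℕ) => insert (w, w + 3) (D.image (sgp w))) '' S n (w + 1) := by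
  ext D
  constructor
  · intro hD
    by_cases hex : ∃ p ∈ D, p.1 = w
    · right
      have hv : ∀ p ∈ D, p.1 ≤ w := fun p hp => Nat.lt_succ_iff.1 (hD.2.2 p hp)
      have hc := contract hD.1 (ear_mem hD.1 hD.2.1 hex hv) hv
      refine ⟨_, ⟨hc.1, ?_, fun p hp => Nat.lt_succ_iff.2 (hc.2.2.1 p hp)⟩, hc.2.2.2⟩
      have := hc.2.1
      have := hD.2.1
      omega
    · left
      push Not at hex
      refine ⟨hD.1, hD.2.1, fun p hp => ?_⟩
      have := hD.2.2 p hp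
      have := hex p hp
      omega
  · rintro (hD | ⟨D', hD', rfl⟩)
    · exact ⟨hD.1, hD.2.1, fun p hp => (hD.2.2 p hp).trans (Nat.lt_succ_self w)⟩
    · exact (expand_mem hw hD').1

lemma S_rec {n w : ℕ} (hw : w ≤ 2 * n) :
    (S (n + 1) (w + 1)).ncard = (S (n + 1) w).ncard + (S n (w + 1)).ncard := by
  rw [S_split hw, Set.ncard_union_eq ?_ (S_finite _ _) ((S_finite _ _).image _), Set.InjOn.ncard_image]
  · intro D hD D' hD' hDD
    have h1 := (expand_mem hw hD).2
    have h2 := (expand_mem hw hD').2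
    have h3 : D.image (sgp w) = D'.image (sgp w) := by
      rw [← Finset.erase_insert h1, ← Finset.erase_insert h2]
      exact congrArg (fun X => Finset.erase X (w, w + 3)) hDD
    exact Finset.image_injective (Function.LeftInverse.injective (tap_sgp w)) h3
  · rw [Set.disjoint_left]
    rintro D hD ⟨D', hD', rfl⟩
    exact lt_irrefl _ (hD.2.2 (w, w + 3) (Finset.mem_insert_self _ _))

lemma S_stay {n w : ℕ} (hw : 2 * n < w) :
    (S (n + 1) (w + 1)).ncard = (S (n + 1) w).ncard := by
  congr 1
  ext D
  refine ⟨fun hD => ⟨hD.1, hD.2.1, fun p hp => ?_⟩, fun hD => ⟨hD.1, hD.2.1, fun p hp => ?_⟩⟩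
  · have := hD.1.1 p hp
    omega
  · have := hD.2.2 p hp
    omega

lemma S_zero (w : ℕ) : (S 0 w).ncard = 1 := by
  rw [Set.ncard_eq_one]
  refine ⟨∅, ?_⟩
  ext D
  simp only [Set.mem_singleton_iff]
  constructor
  · intro h
    exact Finset.card_eq_zero.1 h.2.1
  · rintro rfl
    simp [S, V]

lemma S_succ_zero (n : ℕ) : (S (n + 1) 0).ncard = 0 := by
  rw [Set.ncard_eq_zero (S_finite _ _), Set.eq_empty_iff_forall_notMem]
  intro D hD
  have hne : D.Nonempty := by
    rw [← Finset.card_pos, hD.2.1]; omega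
  obtain ⟨p, hp⟩ := hne
  exact absurd (hD.2.2 p hp) (Nat.not_lt_zero _)

/-- the counting function, cut off at `w ≤ 2 n + 1` -/
noncomputable def f (n w : ℕ) : ℕ := if w ≤ 2 * n + 1 then (S n w).ncard else 0

lemma f_succ_zero (n : ℕ) : f (n + 1) 0 = 0 := by simp [f, S_succ_zero]

lemma f_rec {n w : ℕ} (hw : w + 1 ≤ 2 * n + 3) :
    f (n + 1) (w + 1) = f (n + 1) w + f n (w + 1) := by
  unfold f
  rw [if_pos (by omega), if_pos (by omega)]
  split_ifs with h
  · exact S_rec (by omega)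
  · exact S_stay (by omega)

/-- the Raney numbers -/
def A : ℕ → ℕ → ℕ
  | 0, _ => 1
  | _ + 1, 0 => 0
  | m + 1, r + 1 => A (m + 1) r + A m (r + 3)

lemma A_closed (m : ℕ) : ∀ r, A m (r + 1) * (m.factorial * (2 * m + r + 1).factorial) =
    (r + 1) * (3 * m + r).factorial := by
  induction m with
  | zero => intro r; simp [A, Nat.factorial_succ]
  | succ m ih =>
    intro r
    induction r with
    | zero =>
      have h := ih 2
      rw [A, A]
      have e1 : 2 * (m + 1) + 0 + 1 = 2 * m + 2 + 1 := by ring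
      have e2 : 3 * (m + 1) + 0 = 3 * m + 2 + 1 := by ring
      rw [e1, e2, Nat.factorial_succ m, Nat.factorial_succ (3 * m + 2)]
      linear_combination (m + 1) * h
    | succ r ihr =>
      have h := ih (r + 3)
      rw [A]
      have e1 : 2 * (m + 1) + (r + 1) + 1 = 2 * m + r + 3 + 1 := by ring
      have e2 : 3 * (m + 1) + (r + 1) = 3 * m + r + 3 + 1 := by ring
      have e3 : 2 * (m + 1) + r + 1 = 2 * m + r + 3 := by ring
      have e4 : 3 * (m + 1) + r = 3 * m + r + 3 := by ring
      have e5 : 2 * m + (r + 3) + 1 = 2 * m + r + 3 + 1 := by ring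
      have e6 : 3 * m + (r + 3) = 3 * m + r + 3 := by ring
      rw [e3, e4, Nat.factorial_succ m] at ihr
      rw [e5, e6, Nat.factorial_succ (2 * m + r + 3)] at h
      rw [e1, e2, Nat.factorial_succ m, Nat.factorial_succ (3 * m + r + 3),
        Nat.factorial_succ (2 * m + r + 3)]
      push_cast at *
      have e7 : r + 1 + 3 = r + 3 + 1 := by ring
      rw [e7]
      linear_combination (2 * m + r + 4) * ihr + (m + 1) * h

/-- number of completions -/
def a (N k w : ℕ) : ℕ := A (N - k) (2 * k + 2 - w)

lemma a_rec {N k w : ℕ} (hk : k < N) (hw : w ≤ 2 * k + 1) :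
    a N k w = a N k (w + 1) + a N (k + 1) w := by
  unfold a
  obtain ⟨m, rfl⟩ := Nat.exists_eq_add_of_lt hk
  obtain ⟨r, hr⟩ := Nat.exists_eq_add_of_le hw
  have e1 : k + m + 1 - k = m + 1 := by omega
  have e2 : k + m + 1 - (k + 1) = m := by omega
  have e3 : 2 * k + 2 - w = r + 1 := by omega
  have e4 : 2 * k + 2 - (w + 1) = r := by omega
  have e5 : 2 * (k + 1) + 2 - w = r + 3 := by omega
  rw [e1, e2, e3, e4, e5, A]

lemma Phi_step {N t : ℕ} (hN : 0 < N) (ht : 1 ≤ t) (ht' : t + 1 ≤ 3 * N + 1) :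
    ∑ k ∈ Finset.range (N + 1), f k (t + 1 - k) * a N k (t + 1 - k) =
      ∑ k ∈ Finset.range (N + 1), f k (t - k) * a N k (t - k) := by
  have fz : ∀ k, t ≤ k → f k (t - k) = 0 := by
    intro k hk
    obtain ⟨j, rfl⟩ : ∃ j, k = j + 1 := ⟨k - 1, by omega⟩
    rw [Nat.sub_eq_zero_of_le hk, f_succ_zero]
  have hL : ∑ k ∈ Finset.range (N + 1), f k (t + 1 - k) * a N k (t + 1 - k) =
      ∑ k ∈ Finset.range (N + 1), f k (t - k) * a N k (t + 1 - k) +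
        ∑ j ∈ Finset.range N, f j (t - j) * a N (j + 1) (t - j) := by
    rw [Finset.sum_range_succ' _ N, Finset.sum_range_succ' _ N, add_right_comm,
      ← Finset.sum_add_distrib]
    congr 1
    · refine Finset.sum_congr rfl fun j hj => ?_
      have hj := Finset.mem_range.1 hj
      have e : t + 1 - (j + 1) = t - j := by omega
      rw [e, ← add_mul]
      rcases Nat.lt_or_ge j t with hjt | hjt
      · obtain ⟨w, hw⟩ : ∃ w, t - j = w + 1 := ⟨t - j - 1, by omega⟩
        have e' : t - (j + 1) = w := by omega
        rw [hw, e']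
        rcases Nat.lt_or_ge (2 * j + 3) (w + 1) with h | h
        · have : a N (j + 1) (w + 1) = 0 := by
            unfold a
            have e1 : 2 * (j + 1) + 2 - (w + 1) = 0 := by omega
            obtain ⟨m, hm⟩ : ∃ m, N - (j + 1) = m + 1 := ⟨N - (j + 1) - 1, by omega⟩
            rw [e1, hm, A]
          rw [this]; simp
        · rw [f_rec h]
      · have h1 := fz j hjt
        have h2 := fz (j + 1) (by omega)
        rw [h1, h2]
        have e0 : t - j = 0 := by omega
        rw [e0, f_succ_zero]
    · obtain ⟨M, rfl⟩ : ∃ M, N = M + 1 := ⟨N - 1, by omega⟩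
      have : a (M + 1) 0 (t + 1 - 0) = 0 := by
        unfold a
        have e1 : 2 * 0 + 2 - (t + 1 - 0) = 0 := by omega
        rw [e1, Nat.sub_zero, A]
      rw [this]; simp
  rw [hL, Finset.sum_range_succ, Finset.sum_range_succ, add_right_comm, ← Finset.sum_add_distrib]
  congr 1
  · refine Finset.sum_congr rfl fun j hj => ?_
    have hj := Finset.mem_range.1 hj
    rw [← mul_add]
    rcases Nat.lt_or_ge j t with hjt | hjt
    · by_cases h : t - j ≤ 2 * j + 1
      · rw [a_rec hj h]
        have e : t + 1 - j = t - j + 1 := by omega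
        rw [e]
      · have : f j (t - j) = 0 := by simp only [f, if_neg h]
        rw [this]; simp
    · rw [fz j hjt]; simp
  · simp [a, A]

lemma Phi {N : ℕ} (hN : 0 < N) (t : ℕ) (ht : t + 1 ≤ 3 * N + 1) :
    ∑ k ∈ Finset.range (N + 1), f k (t + 1 - k) * a N k (t + 1 - k) = A N 1 := by
  induction t with
  | zero =>
    rw [Finset.sum_range_succ', Finset.sum_eq_zero]
    · simp [f, a, S_zero]
    · intro k _
      have e : 0 + 1 - (k + 1) = 0 := by omega
      rw [e, f_succ_zero, zero_mul]
  | succ t ih => rw [Phi_step hN (by omega) ht, ih (by omega)]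

lemma S_total {N : ℕ} (hN : 0 < N) : (S N (2 * N + 1)).ncard = A N 1 := by
  rw [← Phi hN (3 * N) le_rfl, Finset.sum_range_succ, Finset.sum_eq_zero]
  · have e : 3 * N + 1 - N = 2 * N + 1 := by omega
    simp [e, f, a, A]
  · intro k hk
    have hk := Finset.mem_range.1 hk
    have h : ¬ (3 * N + 1 - k ≤ 2 * k + 1) := by omega
    simp only [f, if_neg h, zero_mul]

lemma add_root {n : ℕ} (hn : 0 < n) {D : Finset (ℕ × ℕ)} (h : V n D) :
    V n (insert (0, 2 * n + 1) D) := by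
  have key : ∀ q ∈ D, ¬ ChordsCross (0, 2 * n + 1) q ∧ ¬ ChordsCross q (0, 2 * n + 1) := by
    intro q hq
    have h1 := h.1 q hq
    simp only [ChordsCross] at *
    omega
  refine ⟨?_, ?_⟩
  · intro p hp
    rcases Finset.mem_insert.1 hp with rfl | hp
    · dsimp only; omega
    · exact h.1 p hp
  · intro p hp q hq
    rcases Finset.mem_insert.1 hp with rfl | hp <;> rcases Finset.mem_insert.1 hq with rfl | hq
    · simp [ChordsCross]
    · exact (key q hq).1
    · exact (key p hp).2
    · exact h.2 p hp q hq

lemma quad_image {n : ℕ} (hn : 0 < n) :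
    (fun D : Finset (ℕ × ℕ) => insert (0, 2 * n + 1) D) '' {D | IsQuadrangulation n D} =
      S n (2 * n + 1) := by
  ext D
  constructor
  · rintro ⟨D, ⟨hc, hd, hx⟩, rfl⟩
    have hnm : (0, 2 * n + 1) ∉ D := fun hm => (hd _ hm).2.2.2.2 ⟨rfl, rfl⟩
    have hV : V n D := by
      refine ⟨fun p hp => ?_, hx⟩
      obtain ⟨h1, h2, h3, h4, -⟩ := hd p hp
      rw [Nat.odd_iff] at h3
      omega
    have hV' := add_root hn hV
    refine ⟨hV', ?_, fun p hp => ?_⟩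
    · rw [Finset.card_insert_of_notMem hnm, hc]; omega
    · have := hV'.1 p hp
      omega
  · rintro ⟨hV, hc, hl⟩
    have hm : (0, 2 * n + 1) ∈ D := by
      by_contra hm
      have h1 := V_card_le _ _ (add_root hn hV)
      rw [Finset.card_insert_of_notMem hm] at h1
      omega
    refine ⟨D.erase (0, 2 * n + 1), ⟨?_, ?_, ?_⟩, Finset.insert_erase hm⟩
    · rw [Finset.card_erase_of_mem hm, hc]
    · intro p hp
      rw [Finset.mem_erase] at hp
      have h1 := hV.1 p hp.2
      refine ⟨by omega, by omega, Nat.odd_iff.2 h1.2.2, by omega, ?_⟩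
      rintro ⟨h2, h3⟩
      exact hp.1 (Prod.ext h2 h3)
    · intro p hp q hq
      exact hV.2 p (Finset.mem_of_mem_erase hp) q (Finset.mem_of_mem_erase hq)

end QuadCount

/-- The number of quadrangulations of a convex `(2n+2)`-gon equals `(3n)!/(n!·(2n+1)!)`. -/
theorem card_quadrangulations (n : ℕ) :
    {D : Finset (ℕ × ℕ) | IsQuadrangulation n D}.ncard =
      (3 * n).factorial / (n.factorial * (2 * n + 1).factorial) := by
  rcases Nat.eq_zero_or_pos n with rfl | hn
  · have : {D : Finset (ℕ × ℕ) | IsQuadrangulation 0 D} = {∅} := by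
      ext D
      simp only [Set.mem_ofPred_eq, Set.mem_singleton_iff]
      constructor
      · intro h
        exact Finset.card_eq_zero.1 h.1
      · rintro rfl
        simp [IsQuadrangulation]
    rw [this]
    simp
  · have h1 := QuadCount.S_total hn
    rw [← QuadCount.quad_image hn, Set.InjOn.ncard_image] at h1
    · rw [h1]
      have h2 := QuadCount.A_closed n 0
      simp only [Nat.zero_add, Nat.add_zero, Nat.one_mul] at h2
      rw [← h2, Nat.mul_div_cancel _ (by positivity)]
    · intro D hD D' hD' hDD
      have hnm : (0, 2 * n + 1) ∉ D := fun hm => (hD.2.1 _ hm).2.2.2.2 ⟨rfl, rfl⟩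
      have hnm' : (0, 2 * n + 1) ∉ D' := fun hm => (hD'.2.1 _ hm).2.2.2.2 ⟨rfl, rfl⟩
      rw [← Finset.erase_insert hnm, ← Finset.erase_insert hnm']
      exact congrArg (fun X => Finset.erase X (0, 2 * n + 1)) hDD
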